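/- Let G be a connected threshold graph on vertex set {0,1,…,n} (n≥1) labeled by reverse degree sequence. Then Σ_T q^{inv(T)} = Σ_{T increasing} ∏_{i=1}^n [δ_T(i)]_q, where the left-hand sum ranges over all spanning trees T of G rooted at 0, and the right-hand sum ranges over all increasing spanning trees T of G. -/

import Mathlib

open Finset Polynomial

namespace ThresholdFlow

/-- A threshold graph on `{0,…,n}` labeled by reverse degree sequence: whenever `i > j` are
adjacent and `i' ≤ i`, `j' ≤ j`, `i' ≠ j'`, then `i'` and `j'` are adjacent. -/
def IsThreshold (n : ℕ) (G : SimpleGraph (Fin (n+1))) : Prop :=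
  ∀ i j i' j' : Fin (n+1), j < i → G.Adj i j → i' ≤ i → j' ≤ j → i' ≠ j' → G.Adj i' j'

/-- An integer `a`-flow on `G`: nonnegative integers on the edges of `G` (oriented from the
larger endpoint `i` to the smaller endpoint `j`, recorded as `f i j`), with net flow `a i`
at every vertex `i ≠ 0`. -/
def IsFlow (n : ℕ) (G : SimpleGraph (Fin (n+1))) (a : Fin (n+1) → ℕ)
    (f : Fin (n+1) → Fin (n+1) → ℕ) : Prop :=
  (∀ i j, f i j ≠ 0 → j < i ∧ G.Adj i j) ∧
  (∀ i : Fin (n+1), i ≠ 0 → ∑ j, f i j = a i + ∑ j, f j i)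

/-- The number of positive entries of a flow. -/
def posCount (n : ℕ) (f : Fin (n+1) → Fin (n+1) → ℕ) : ℕ :=
  (Finset.univ.filter fun pr : Fin (n+1) × Fin (n+1) => 0 < f pr.1 pr.2).card

/-- `[b]_q = 1 + q + ⋯ + q^(b-1)` as a polynomial in `ℤ[q]`. -/
noncomputable def qnat (b : ℕ) : Polynomial ℤ := ∑ k ∈ Finset.range b, X ^ k

/-- `Ehr_{q,1}(F_G(a))`: the sum over integer `a`-flows with exactly `n` positive entries of
`∏_{e : f(e) > 0} [f(e)]_q`. -/
noncomputable def Ehr1 (n : ℕ) (G : SimpleGraph (Fin (n+1))) (a : Fin (n+1) → ℕ) :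
    Polynomial ℤ :=
  ∑ᶠ f ∈ {f | IsFlow n G a f ∧ posCount n f = n},
    ∏ i, ∏ j, if 0 < f i j then qnat (f i j) else 1

/-- `Ehr_{q,0}(F_G(a))`: the sum over all integer `a`-flows of
`(q-1)^(s(f)-n) ∏_{e : f(e) > 0} q^(f(e)-1)`. -/
noncomputable def Ehr0 (n : ℕ) (G : SimpleGraph (Fin (n+1))) (a : Fin (n+1) → ℕ) :
    Polynomial ℤ :=
  ∑ᶠ f ∈ {f | IsFlow n G a f},
    (X - 1) ^ (posCount n f - n) * ∏ i, ∏ j, if 0 < f i j then X ^ (f i j - 1) else 1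

/-- `Ehr_{1,1}(F_G(a))`: the sum over integer `a`-flows with exactly `n` positive entries of
the product of the positive entries. -/
noncomputable def Ehr11 (n : ℕ) (G : SimpleGraph (Fin (n+1))) (a : Fin (n+1) → ℕ) : ℕ :=
  ∑ᶠ f ∈ {f | IsFlow n G a f ∧ posCount n f = n},
    ∏ i, ∏ j, if 0 < f i j then f i j else 1

/-- A spanning tree of `G` rooted at `0`, encoded by its parent function `p`:
`p 0 = 0`, each `i ≠ 0` is adjacent in `G` to its parent `p i`, and iterating the parent
function from any vertex reaches the root `0`. -/
def IsSpanTree (n : ℕ) (G : SimpleGraph (Fin (n+1))) (p : Fin (n+1) → Fin (n+1)) : Prop :=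
  p 0 = 0 ∧ (∀ i, i ≠ 0 → G.Adj i (p i)) ∧ ∀ i, ∃ k, p^[k] i = 0

/-- `j` is a descendant of `i` in the rooted tree with parent function `p`
(in particular every vertex is a descendant of itself). -/
def Desc (n : ℕ) (p : Fin (n+1) → Fin (n+1)) (i j : Fin (n+1)) : Prop :=
  ∃ k, p^[k] j = i

/-- The set of inversions of the rooted tree `p`: pairs `(i,j)` with `i > j`, `i ≠ 0` and
`j` a descendant of `i`. -/
def invSet (n : ℕ) (p : Fin (n+1) → Fin (n+1)) : Set (Fin (n+1) × Fin (n+1)) :=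
  {pr | pr.2 < pr.1 ∧ pr.1 ≠ 0 ∧ Desc n p pr.1 pr.2}

/-- The number of inversions of the rooted tree `p`. -/
noncomputable def treeInv (n : ℕ) (p : Fin (n+1) → Fin (n+1)) : ℕ := (invSet n p).ncard

/-- A rooted spanning tree is increasing if it has no inversions. -/
def IsIncr (n : ℕ) (p : Fin (n+1) → Fin (n+1)) : Prop := invSet n p = ∅

/-- `δ_T(i)`: the number of descendants of `i` (including `i` itself). -/
noncomputable def delta (n : ℕ) (p : Fin (n+1) → Fin (n+1)) (i : Fin (n+1)) : ℕ :=
  Set.ncard {j | Desc n p i j}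

/-- `δ_T^a(i) = Σ_j a_j`, summed over the descendants `j` of `i` (including `i` itself). -/
noncomputable def deltaA (n : ℕ) (a : Fin (n+1) → ℕ) (p : Fin (n+1) → Fin (n+1))
    (i : Fin (n+1)) : ℕ :=
  ∑ᶠ j ∈ {j | Desc n p i j}, a j

/-- The degree `d_i` of vertex `i` in `G`. -/
noncomputable def deg (n : ℕ) (G : SimpleGraph (Fin (n+1))) (i : Fin (n+1)) : ℕ :=
  Set.ncard {j | G.Adj i j}

/-- `d̄_i`: the number of neighbors of `i` smaller than `i`. -/
noncomputable def dbar (n : ℕ) (G : SimpleGraph (Fin (n+1))) (i : Fin (n+1)) : ℕ :=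
  Set.ncard {j | j < i ∧ G.Adj i j}

/-- A `G`-parking function, encoded as `P : Fin (n+1) → ℕ` with `P 0 = 0`. -/
def IsParking (n : ℕ) (G : SimpleGraph (Fin (n+1))) (P : Fin (n+1) → ℕ) : Prop :=
  P 0 = 0 ∧ ∀ S : Finset (Fin (n+1)), S.Nonempty → (0 : Fin (n+1)) ∉ S →
    ∃ i ∈ S, P i < Set.ncard {j | j ∉ S ∧ G.Adj i j}

/-- `codeg(P) = (|E(G)| - n) - Σ_{i=1}^n P(i)`. -/
noncomputable def codeg (n : ℕ) (G : SimpleGraph (Fin (n+1))) (P : Fin (n+1) → ℕ) : ℕ :=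
  (Set.ncard G.edgeSet - n) - ∑ i, P i

/-- `[m]_q` as a Laurent polynomial. -/
noncomputable def lq (m : ℕ) : LaurentPolynomial ℤ :=
  ∑ k ∈ Finset.range m, LaurentPolynomial.T (k : ℤ)

/-- `[b]_{q^m} = 1 + q^m + ⋯ + q^{m(b-1)}` as a Laurent polynomial. -/
noncomputable def lqpow (m b : ℕ) : LaurentPolynomial ℤ :=
  ∑ k ∈ Finset.range b, LaurentPolynomial.T ((m : ℤ) * k)

/-- `wt_{q,q⁻¹}(b)`: the substitution `t = q⁻¹` in `wt_{q,t}(b) = Σ_{k=0}^{b-1} q^k t^{b-1-k}`,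
with `wt_{q,q⁻¹}(0) = 1`. -/
noncomputable def wtqq (b : ℕ) : LaurentPolynomial ℤ :=
  if b = 0 then 1 else ∑ k ∈ Finset.range b, LaurentPolynomial.T (2 * (k : ℤ) - ((b : ℤ) - 1))

/-- `Ehr_{q,q⁻¹}(F_G(a))`: the sum over all integer `a`-flows `f` of
`(-(1-q)(1-q⁻¹))^(s(f)-n) ∏_e wt_{q,q⁻¹}(f(e))`, as a Laurent polynomial in `q`. -/
noncomputable def Ehrqq (n : ℕ) (G : SimpleGraph (Fin (n+1))) (a : Fin (n+1) → ℕ) :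
    LaurentPolynomial ℤ :=
  ∑ᶠ f ∈ {f | IsFlow n G a f},
    (-((1 - LaurentPolynomial.T 1) * (1 - LaurentPolynomial.T (-1)))) ^ (posCount n f - n) *
      ∏ i, ∏ j, wtqq (f i j)

end ThresholdFlow

namespace ThresholdFlow

open scoped Classical

section Trees

variable {n : ℕ}

/-- The descendant set. -/
noncomputable def dset (p : Fin (n+1) → Fin (n+1)) (i : Fin (n+1)) : Finset (Fin (n+1)) :=
  Finset.univ.filter (fun j => Desc n p i j)

/-- `p` encodes a spanning tree of `G[A]` rooted at `r`. -/
def IsT (G : SimpleGraph (Fin (n+1))) (A : Finset (Fin (n+1))) (r : Fin (n+1))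
    (p : Fin (n+1) → Fin (n+1)) : Prop :=
  (∀ x, x ∉ A → p x = x) ∧ p r = r ∧ (∀ x ∈ A, x ≠ r → p x ∈ A ∧ G.Adj x (p x)) ∧
    ∀ x ∈ A, Desc n p r x

/-- Weighted sum over trees on `A` rooted at `r`. -/
noncomputable def W (G : SimpleGraph (Fin (n+1)))
    (w : Fin (n+1) → Finset (Fin (n+1)) → Polynomial ℤ)
    (A : Finset (Fin (n+1))) (r : Fin (n+1)) : Polynomial ℤ :=
  ∑ p ∈ Finset.univ.filter (fun p => IsT G A r p), ∏ i ∈ A.erase r, w i (dset p i)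

variable {G : SimpleGraph (Fin (n+1))} {A b : Finset (Fin (n+1))} {r c s : Fin (n+1)}
  {p p1 p2 : Fin (n+1) → Fin (n+1)}

theorem mem_dset {i j : Fin (n+1)} : j ∈ dset p i ↔ Desc n p i j := by simp [dset]

theorem desc_refl (i : Fin (n+1)) : Desc n p i i := ⟨0, rfl⟩

theorem desc_step {i x : Fin (n+1)} (h : Desc n p i (p x)) : Desc n p i x := by
  obtain ⟨k, hk⟩ := h
  exact ⟨k+1, by simpa [Function.iterate_succ_apply] using hk⟩

theorem desc_cases {i x : Fin (n+1)} (h : Desc n p i x) : x = i ∨ Desc n p i (p x) := by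
  obtain ⟨k, hk⟩ := h
  cases k with
  | zero => left; simpa using hk
  | succ k => right; exact ⟨k, by simpa [Function.iterate_succ_apply] using hk⟩

/-- Induction principle for descendants. -/
theorem desc_ind {i : Fin (n+1)} {P : Fin (n+1) → Prop} (h0 : P i)
    (h1 : ∀ x, Desc n p i x → P (p x) → P x) {x : Fin (n+1)} (h : Desc n p i x) : P x := by
  obtain ⟨k, hk⟩ := h
  induction k generalizing x with
  | zero => simp at hk; subst hk; exact h0
  | succ k ih =>
    rw [Function.iterate_succ_apply] at hk
    exact h1 x (desc_step ⟨k, hk⟩) (ih hk)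

theorem desc_closed {S : Finset (Fin (n+1))} (hS : ∀ x ∈ S, p x ∈ S) {i x : Fin (n+1)}
    (hx : x ∈ S) (h : Desc n p i x) : i ∈ S := by
  revert hx
  exact desc_ind (P := fun x => x ∈ S → i ∈ S) id (fun x _ ih hx => ih (hS x hx)) h

theorem desc_fixed {i x : Fin (n+1)} (hx : p x = x) (h : Desc n p i x) : i = x := by
  have := desc_closed (p := p) (S := {x}) (by simp [hx]) (by simp) h
  simpa using this

theorem exists_branch {s : Fin (n+1)} (hr : p r = r) (hs : s ≠ r) (h : Desc n p r s) :
    ∃ c, p c = r ∧ c ≠ r ∧ Desc n p c s := by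
  revert hs
  refine desc_ind (P := fun s => s ≠ r → ∃ c, p c = r ∧ c ≠ r ∧ Desc n p c s) ?_ ?_ h
  · intro h; exact absurd rfl h
  · intro x _ ih hx
    by_cases hp : p x = r
    · exact ⟨x, hp, hx, desc_refl x⟩
    · obtain ⟨c, h1, h2, h3⟩ := ih hp
      exact ⟨c, h1, h2, desc_step h3⟩

theorem branch_unique {s c c' : Fin (n+1)} (hr : p r = r)
    (h1 : p c = r) (h2 : c ≠ r) (h3 : Desc n p c s)
    (h1' : p c' = r) (h2' : c' ≠ r) (h3' : Desc n p c' s) : c = c' := by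
  revert h3'
  refine desc_ind (P := fun s => Desc n p c' s → c = c') ?_ ?_ h3
  · intro h
    rcases desc_cases h with h | h
    · exact h
    · rw [h1] at h
      exact absurd (desc_fixed hr h) h2'
  · intro x hx ih h
    rcases desc_cases h with h | h
    · subst h
      rcases desc_cases hx with h | h
      · exact h.symm
      · rw [h1'] at h
        exact absurd (desc_fixed hr h) h2
    · exact ih h

/-- Glue two trees. -/
noncomputable def glue (b : Finset (Fin (n+1))) (c r : Fin (n+1)) (p1 p2 : Fin (n+1) → Fin (n+1)) :
    Fin (n+1) → Fin (n+1) :=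
  fun x => if x = c then r else if x ∈ b then p1 x else p2 x

/-- The part inside `b`. -/
noncomputable def split1 (b : Finset (Fin (n+1))) (c : Fin (n+1)) (p : Fin (n+1) → Fin (n+1)) :
    Fin (n+1) → Fin (n+1) :=
  fun x => if x ∈ b ∧ x ≠ c then p x else x

/-- The part outside `b`. -/
noncomputable def split2 (b : Finset (Fin (n+1))) (p : Fin (n+1) → Fin (n+1)) :
    Fin (n+1) → Fin (n+1) :=
  fun x => if x ∈ b then x else p x

theorem glue_out (hc : c ∈ b) {x : Fin (n+1)} (hx : x ∉ b) : glue b c r p1 p2 x = p2 x := by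
  have : x ≠ c := fun h => hx (h ▸ hc)
  simp [glue, this, hx]

theorem glue_in {x : Fin (n+1)} (hx : x ∈ b) (hxc : x ≠ c) : glue b c r p1 p2 x = p1 x := by
  simp [glue, hx, hxc]

theorem glue_c : glue b c r p1 p2 c = r := by simp [glue]

theorem tree_desc_mem (h : IsT G A r p) {i x : Fin (n+1)} (hi : i ∈ A) (hd : Desc n p i x) :
    x ∈ A := by
  by_contra hx
  have := desc_fixed (h.1 x hx) hd
  exact hx (this ▸ hi)

theorem tree_map (h : IsT G A r p) (hr : r ∈ A) : ∀ x ∈ A, p x ∈ A := by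
  intro x hx
  by_cases hxr : x = r
  · rw [hxr, h.2.1]; exact hr
  · exact (h.2.2.1 x hx hxr).1

theorem glue_desc_in (hb : b ⊆ A.erase r) (hc : c ∈ b) (hr : r ∈ A) (h1 : IsT G b c p1)
    (h2 : IsT G (A \ b) r p2)
    {i : Fin (n+1)} (hi : i ∈ b) (x : Fin (n+1)) :
    Desc n (glue b c r p1 p2) i x ↔ Desc n p1 i x := by
  have hrb : r ∉ b := fun h => by simpa using hb h
  have hgr : glue b c r p1 p2 r = r := by rw [glue_out hc hrb, h2.2.1]
  have hout : ∀ x, x ∉ b → glue b c r p1 p2 x ∉ b := by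
    intro x hx
    rw [glue_out hc hx]
    by_cases hxA : x ∈ A
    · exact (Finset.mem_sdiff.1 (tree_map h2 (by simp [hr, hrb]) x (by simp [hxA, hx]))).2
    · rw [h2.1 x (by simp [hxA])]; exact hx
  have hxb : ∀ x, Desc n (glue b c r p1 p2) i x → x ∈ b := by
    intro x h
    by_contra hx
    have := desc_closed (p := glue b c r p1 p2) (S := bᶜ) (by simpa using hout) (by simpa using hx) h
    simp [hi] at this
  constructor
  · intro h
    refine desc_ind (P := fun x => Desc n p1 i x) (desc_refl i) ?_ h
    intro x hx ih
    have := hxb x hx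
    by_cases hxc : x = c
    · subst hxc
      rcases desc_cases hx with h | h
      · rw [h]; exact desc_refl i
      · rw [glue_c] at h
        have := desc_fixed hgr h
        exact absurd (this ▸ hi) hrb
    · rw [glue_in this hxc] at ih
      exact desc_step ih
  · intro h
    refine desc_ind (P := fun x => Desc n (glue b c r p1 p2) i x) (desc_refl i) ?_ h
    intro x hx ih
    by_cases hxc : x = c
    · subst hxc
      rwa [h1.2.1] at ih
    · rw [← glue_in (r := r) (p1 := p1) (p2 := p2) (tree_desc_mem h1 hi hx) hxc] at ih
      exact desc_step ih

theorem glue_desc_out (hb : b ⊆ A.erase r) (hc : c ∈ b) (hr : r ∈ A)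
    (h2 : IsT G (A \ b) r p2) {i x : Fin (n+1)} (hx : x ∉ b) :
    Desc n (glue b c r p1 p2) i x ↔ Desc n p2 i x := by
  have hrb : r ∉ b := fun h => by simpa using hb h
  have hout : ∀ x, x ∉ b → p2 x ∉ b := by
    intro x hx
    by_cases hxA : x ∈ A
    · exact (Finset.mem_sdiff.1 (tree_map h2 (by simp [hr, hrb]) x (by simp [hxA, hx]))).2
    · rw [h2.1 x (by simp [hxA])]; exact hx
  constructor
  · intro h
    refine desc_ind (P := fun x => x ∉ b → Desc n p2 i x) (fun _ => desc_refl i) ?_ h hx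
    intro x _ ih hx
    rw [glue_out hc hx] at ih
    exact desc_step (ih (hout x hx))
  · intro h
    refine desc_ind (P := fun x => x ∉ b → Desc n (glue b c r p1 p2) i x)
      (fun _ => desc_refl i) ?_ h hx
    intro x _ ih hx
    have := ih (hout x hx)
    rw [← glue_out (r := r) (p1 := p1) (p2 := p2) hc hx] at this
    exact desc_step this

theorem glue_desc_out' (hb : b ⊆ A.erase r) (hc : c ∈ b) (hr : r ∈ A) (h1 : IsT G b c p1)
    (h2 : IsT G (A \ b) r p2) {i : Fin (n+1)} (hi : i ∈ A \ b) (hir : i ≠ r) (x : Fin (n+1)) :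
    Desc n (glue b c r p1 p2) i x ↔ Desc n p2 i x := by
  have hrb : r ∉ b := fun h => by simpa using hb h
  by_cases hx : x ∈ b
  · have hib := (Finset.mem_sdiff.1 hi).2
    constructor
    · intro h
      have := desc_closed (p := glue b c r p1 p2) (S := insert r b) ?_ (by simp [hx]) h
      · simp [hir, hib] at this
      · intro y hy
        rcases Finset.mem_insert.1 hy with rfl | hy
        · rw [glue_out hc hrb, h2.2.1]; simp
        · by_cases hyc : y = c
          · subst hyc; rw [glue_c]; simp
          · rw [glue_in hy hyc]
            exact Finset.mem_insert_of_mem (tree_map h1 hc y hy)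
    · intro h
      have := desc_fixed (h2.1 x (by simp [hx])) h
      exact absurd (this ▸ hx) hib
  · exact glue_desc_out hb hc hr h2 hx

theorem glue_tree (hb : b ⊆ A.erase r) (hc : c ∈ b) (hr : r ∈ A) (hcr : G.Adj c r)
    (h1 : IsT G b c p1) (h2 : IsT G (A \ b) r p2) :
    IsT G A r (glue b c r p1 p2) ∧ glue b c r p1 p2 c = r ∧ dset (glue b c r p1 p2) c = b := by
  have hrb : r ∉ b := fun h => by simpa using hb h
  have hbA : ∀ x ∈ b, x ∈ A := fun x hx => (Finset.mem_erase.1 (hb hx)).2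
  have hgr : glue b c r p1 p2 r = r := by rw [glue_out hc hrb, h2.2.1]
  refine ⟨⟨?_, hgr, ?_, ?_⟩, glue_c, ?_⟩
  · intro x hx
    rw [glue_out hc (fun h => hx (hbA x h)), h2.1 x (by simp [hx])]
  · intro x hx hxr
    by_cases hxb : x ∈ b
    · by_cases hxc : x = c
      · subst hxc; rw [glue_c]; exact ⟨hr, hcr⟩
      · rw [glue_in hxb hxc]
        exact ⟨hbA _ (h1.2.2.1 x hxb hxc).1, (h1.2.2.1 x hxb hxc).2⟩
    · rw [glue_out hc hxb]
      have := h2.2.2.1 x (by simp [hx, hxb]) hxr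
      exact ⟨(Finset.mem_sdiff.1 this.1).1, this.2⟩
  · intro x hx
    by_cases hxb : x ∈ b
    · have h := (glue_desc_in hb hc hr h1 h2 hc x).2 (h1.2.2.2 x hxb)
      refine desc_ind (P := fun x => Desc n (glue b c r p1 p2) r x) ?_ ?_ h
      · apply desc_step; rw [glue_c]; exact desc_refl r
      · intro x _ ih; exact desc_step ih
    · exact (glue_desc_out hb hc hr h2 hxb).2 (h2.2.2.2 x (by simp [hx, hxb]))
  · ext x
    rw [mem_dset, glue_desc_in hb hc hr h1 h2 hc x]
    exact ⟨tree_desc_mem h1 hc, h1.2.2.2 x⟩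

theorem split_tree (hb : b ⊆ A.erase r) (hc : c ∈ b) (hr : r ∈ A)
    (h : IsT G A r p) (hpc : p c = r) (hd : dset p c = b) :
    IsT G b c (split1 b c p) ∧ IsT G (A \ b) r (split2 b p) ∧
      glue b c r (split1 b c p) (split2 b p) = p := by
  have hrb : r ∉ b := fun h => by simpa using hb h
  have hbA : ∀ x ∈ b, x ∈ A := fun x hx => (Finset.mem_erase.1 (hb hx)).2
  have hdb : ∀ x, x ∈ b ↔ Desc n p c x := fun x => by rw [← hd, mem_dset]
  refine ⟨⟨?_, ?_, ?_, ?_⟩, ⟨?_, ?_, ?_, ?_⟩, ?_⟩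
  · intro x hx; simp [split1, hx]
  · simp [split1]
  · intro x hx hxc
    have hxr : x ≠ r := fun h => hrb (h ▸ hx)
    simp only [split1, hx, hxc, ne_eq, not_false_eq_true, and_self, if_true]
    refine ⟨?_, (h.2.2.1 x (hbA x hx) hxr).2⟩
    rw [hdb] at hx ⊢
    rcases desc_cases hx with h | h
    · exact absurd h hxc
    · exact h
  · intro x hx
    refine desc_ind (P := fun x => Desc n (split1 b c p) c x) (desc_refl c) ?_ ((hdb x).1 hx)
    intro x hx ih
    by_cases hxc : x = c
    · rw [hxc]; exact desc_refl c
    · apply desc_step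
      have : split1 b c p x = p x := by simp [split1, (hdb x).2 hx, hxc]
      rwa [this]
  · intro x hx
    by_cases hxb : x ∈ b
    · simp [split2, hxb]
    · have : x ∉ A := fun h => hx (by simp [h, hxb])
      simp [split2, hxb, h.1 x this]
  · simp [split2, hrb, h.2.1]
  · intro x hx hxr
    obtain ⟨hxA, hxb⟩ := Finset.mem_sdiff.1 hx
    have := h.2.2.1 x hxA hxr
    simp only [split2, hxb, if_false]
    refine ⟨Finset.mem_sdiff.2 ⟨this.1, ?_⟩, this.2⟩
    intro h'
    exact hxb ((hdb x).2 (desc_step ((hdb _).1 h')))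
  · intro x hx
    obtain ⟨hxA, hxb⟩ := Finset.mem_sdiff.1 hx
    refine desc_ind (P := fun x => x ∉ b → Desc n (split2 b p) r x) (fun _ => desc_refl r) ?_
      (h.2.2.2 x hxA) hxb
    intro x _ ih hxb
    apply desc_step
    have : split2 b p x = p x := by simp [split2, hxb]
    rw [this]
    apply ih
    intro h'
    exact hxb ((hdb x).2 (desc_step ((hdb _).1 h')))
  · funext x
    by_cases hxc : x = c
    · subst hxc; rw [glue_c, hpc]
    · by_cases hxb : x ∈ b
      · rw [glue_in hxb hxc]; simp [split1, hxb, hxc]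
      · rw [glue_out hc hxb]; simp [split2, hxb]

theorem fiber_sum (w : Fin (n+1) → Finset (Fin (n+1)) → Polynomial ℤ)
    (hb : b ⊆ A.erase r) (hc : c ∈ b) (hr : r ∈ A) (hcr : G.Adj c r) :
    ∑ p ∈ Finset.univ.filter (fun p => IsT G A r p ∧ p c = r ∧ dset p c = b),
      ∏ i ∈ A.erase r, w i (dset p i) = w c b * W G w b c * W G w (A \ b) r := by
  have hrb : r ∉ b := fun h => by simpa using hb h
  rw [mul_assoc, W, W, Finset.sum_mul_sum, ← Finset.sum_product', Finset.mul_sum]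
  symm
  refine Finset.sum_nbij' (fun q => glue b c r q.1 q.2) (fun p => (split1 b c p, split2 b p))
    ?_ ?_ ?_ ?_ ?_
  · rintro ⟨p1, p2⟩ h
    simp only [Finset.mem_product, Finset.mem_filter, Finset.mem_univ, true_and] at h ⊢
    exact glue_tree hb hc hr hcr h.1 h.2
  · intro p h
    simp only [Finset.mem_product, Finset.mem_filter, Finset.mem_univ, true_and] at h ⊢
    have := split_tree hb hc hr h.1 h.2.1 h.2.2
    exact ⟨this.1, this.2.1⟩
  · rintro ⟨p1, p2⟩ h
    simp only [Finset.mem_product, Finset.mem_filter, Finset.mem_univ, true_and] at h ⊢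
    obtain ⟨h1, h2⟩ := h
    refine Prod.ext ?_ ?_
    · funext x
      by_cases hxb : x ∈ b
      · by_cases hxc : x = c
        · subst hxc; simp [split1, h1.2.1]
        · simp [split1, hxb, hxc, glue_in hxb hxc]
      · simp [split1, hxb, h1.1 x hxb]
    · funext x
      by_cases hxb : x ∈ b
      · simp [split2, hxb, h2.1 x (by simp [hxb])]
      · simp [split2, hxb, glue_out hc hxb]
  · intro p h
    simp only [Finset.mem_filter, Finset.mem_univ, true_and] at h
    exact (split_tree hb hc hr h.1 h.2.1 h.2.2).2.2
  · rintro ⟨p1, p2⟩ h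
    simp only [Finset.mem_product, Finset.mem_filter, Finset.mem_univ, true_and] at h ⊢
    obtain ⟨h1, h2⟩ := h
    have hsplit : A.erase r = b ∪ (A \ b).erase r := by
      ext x
      have := @hb x
      simp only [Finset.mem_erase, Finset.mem_union, Finset.mem_sdiff] at this ⊢
      tauto
    have hdisj : Disjoint b ((A \ b).erase r) := by
      rw [Finset.disjoint_left]; intro x hx; simp [hx]
    rw [hsplit, Finset.prod_union hdisj, ← Finset.mul_prod_erase b _ hc,
      (glue_tree hb hc hr hcr h1 h2).2.2, mul_assoc]
    congr 2
    · refine Finset.prod_congr rfl fun i hi => ?_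
      congr 1
      ext x
      rw [mem_dset, mem_dset, glue_desc_in hb hc hr h1 h2 (Finset.mem_of_mem_erase hi)]
    · refine Finset.prod_congr rfl fun i hi => ?_
      congr 1
      ext x
      rw [mem_dset, mem_dset, glue_desc_out' hb hc hr h1 h2 (Finset.mem_of_mem_erase hi)
        (Finset.ne_of_mem_erase hi)]

theorem W_rec (w : Fin (n+1) → Finset (Fin (n+1)) → Polynomial ℤ)
    (hr : r ∈ A) (hs : s ∈ A) (hsr : s ≠ r) :
    W G w A r = ∑ b ∈ (A.erase r).powerset.filter (fun b => s ∈ b),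
      ∑ c ∈ b.filter (fun c => G.Adj c r), w c b * W G w b c * W G w (A \ b) r := by
  have key : ∀ b ∈ (A.erase r).powerset.filter (fun b => s ∈ b),
      ∑ c ∈ b.filter (fun c => G.Adj c r), w c b * W G w b c * W G w (A \ b) r =
      ∑ c ∈ b.filter (fun c => G.Adj c r), ∑ p ∈ Finset.univ.filter (fun p => IsT G A r p),
        if p c = r ∧ dset p c = b then ∏ i ∈ A.erase r, w i (dset p i) else 0 := by
    intro b hb
    simp only [Finset.mem_filter, Finset.mem_powerset] at hb
    refine Finset.sum_congr rfl fun c hc => ?_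
    simp only [Finset.mem_filter] at hc
    rw [← fiber_sum w hb.1 hc.1 hr hc.2, ← Finset.sum_filter, Finset.filter_filter]
  rw [Finset.sum_congr rfl key, Finset.sum_sigma', Finset.sum_comm, W]
  refine Finset.sum_congr rfl fun p hp => ?_
  simp only [Finset.mem_filter, Finset.mem_univ, true_and] at hp
  obtain ⟨c, h1, h2, h3⟩ := exists_branch hp.2.1 hsr (hp.2.2.2 s hs)
  have hcA : c ∈ A := by
    by_contra h
    have := hp.1 c h
    rw [h1] at this
    exact h2 this.symm
  rw [Finset.sum_eq_single ⟨dset p c, c⟩]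
  · simp [h1]
  · rintro ⟨b, c'⟩ hb hne
    simp only [Finset.mem_sigma, Finset.mem_filter, Finset.mem_powerset] at hb
    rw [if_neg]
    rintro ⟨e1, e2⟩
    apply hne
    have hc' : c' ≠ r := fun h => by simpa [h] using hb.1.1 hb.2.1
    have : c = c' := branch_unique hp.2.1 h1 h2 h3 e1 hc' (by rw [← mem_dset, e2]; exact hb.1.2)
    subst this
    simp at e2
    rw [e2]
  · intro h
    exfalso
    apply h
    simp only [Finset.mem_sigma, Finset.mem_filter, Finset.mem_powerset, mem_dset]
    refine ⟨⟨?_, h3⟩, desc_refl c, ?_⟩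
    · intro x hx
      rw [mem_dset] at hx
      refine Finset.mem_erase.2 ⟨?_, tree_desc_mem hp hcA hx⟩
      rintro rfl
      exact h2 (desc_fixed hp.2.1 hx)
    · have := (hp.2.2.1 c hcA h2).2
      rwa [h1] at this

theorem W_single (w : Fin (n+1) → Finset (Fin (n+1)) → Polynomial ℤ) (r : Fin (n+1)) :
    W G w {r} r = 1 := by
  have : Finset.univ.filter (fun p => IsT G {r} r p) = {id} := by
    ext p
    simp only [Finset.mem_filter, Finset.mem_univ, true_and, Finset.mem_singleton]
    constructor
    · intro h
      funext x
      by_cases hx : x = r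
      · rw [hx, h.2.1]; rfl
      · exact h.1 x (by simpa using hx)
    · rintro rfl
      refine ⟨fun _ _ => rfl, rfl, ?_, ?_⟩
      · intro x hx hxr; exact absurd (Finset.mem_singleton.1 hx) hxr
      · intro x hx; rw [Finset.mem_singleton.1 hx]; exact desc_refl r
  rw [W, this]; simp

end Trees
end ThresholdFlow

namespace ThresholdFlow

open scoped Classical

section Algebra

variable {n : ℕ}

/-- inversion weight -/
noncomputable def winv (i : Fin (n+1)) (D : Finset (Fin (n+1))) : Polynomial ℤ :=
  X ^ (D.filter (fun j => j < i)).card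

/-- increasing weight -/
noncomputable def winc (i : Fin (n+1)) (D : Finset (Fin (n+1))) : Polynomial ℤ :=
  if ∀ j ∈ D, i ≤ j then qnat D.card else 0

/-- number of neighbours of `r` in `b` -/
noncomputable def nb (G : SimpleGraph (Fin (n+1))) (r : Fin (n+1)) (b : Finset (Fin (n+1))) : ℕ :=
  (b.filter (fun c => G.Adj c r)).card

/-- number of edges inside `A` -/
noncomputable def ne (G : SimpleGraph (Fin (n+1))) (A : Finset (Fin (n+1))) : ℕ :=
  ∑ x ∈ A, (A.filter (fun y => y < x ∧ G.Adj x y)).card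

/-- edge weight -/
noncomputable def gw (G : SimpleGraph (Fin (n+1))) (A : Finset (Fin (n+1))) : Polynomial ℤ :=
  X ^ ne G A

variable {G : SimpleGraph (Fin (n+1))} {A B b : Finset (Fin (n+1))} {r c s : Fin (n+1)}

theorem ne_insert (hr : r ∉ A) : ne G (insert r A) = nb G r A + ne G A := by
  rw [ne, Finset.sum_insert hr]
  have h1 : (Finset.filter (fun y => y < r ∧ G.Adj r y) (insert r A)).card =
      ∑ x ∈ A, if x < r ∧ G.Adj x r then 1 else 0 := by
    rw [Finset.filter_insert, if_neg (by simp), Finset.card_filter]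
    simp [G.adj_comm]
  have h2 : ∀ x ∈ A, (Finset.filter (fun y => y < x ∧ G.Adj x y) (insert r A)).card =
      (if r < x ∧ G.Adj x r then 1 else 0) + (A.filter (fun y => y < x ∧ G.Adj x y)).card := by
    intro x hx
    rw [Finset.filter_insert]
    split_ifs with h
    · rw [Finset.card_insert_of_notMem (by simp [hr]), add_comm]
    · simp
  rw [h1, Finset.sum_congr rfl h2, Finset.sum_add_distrib, ← add_assoc, ← Finset.sum_add_distrib,
    ← ne, nb, Finset.card_filter]
  congr 1
  refine Finset.sum_congr rfl fun x hx => ?_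
  have hxr : x ≠ r := fun h => hr (h ▸ hx)
  rcases lt_or_gt_of_ne hxr with h | h <;> simp [h, h.not_gt]

theorem gw_insert (hr : r ∉ A) : gw G (insert r A) = X ^ nb G r A * gw G A := by
  rw [gw, ne_insert hr, pow_add, gw]

theorem gw_empty : gw G ∅ = 1 := by simp [gw, ne]

theorem nb_sdiff (h : b ⊆ A) : nb G r A = nb G r b + nb G r (A \ b) := by
  rw [nb, nb, nb, ← Finset.card_union_of_disjoint, ← Finset.filter_union,
    Finset.union_sdiff_of_subset h]
  exact Finset.disjoint_filter_filter Finset.disjoint_sdiff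

theorem sum_rank (S : Finset (Fin (n+1))) :
    ∑ c ∈ S, (X : Polynomial ℤ) ^ (S.filter (fun j => j < c)).card = qnat S.card := by
  induction S using Finset.induction_on_max with
  | empty => simp [qnat]
  | insert a S ha ih =>
    have haS : a ∉ S := fun h => lt_irrefl _ (ha a h)
    rw [Finset.sum_insert haS, Finset.card_insert_of_notMem haS, qnat, Finset.sum_range_succ,
      ← qnat, ← ih, add_comm]
    congr 1
    · refine Finset.sum_congr rfl fun c hc => ?_
      rw [Finset.filter_insert, if_neg (ha c hc).not_gt]
    · congr 2
      rw [Finset.filter_insert, if_neg (lt_irrefl a), Finset.filter_true_of_mem ha]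

/-- Down-closed neighbourhoods. -/
def DC (G : SimpleGraph (Fin (n+1))) : Prop :=
  ∀ a i j : Fin (n+1), G.Adj i a → j < i → j ≠ a → G.Adj j a

theorem dc_of_threshold (h : IsThreshold n G) : DC G := by
  intro a i j hia hji hja
  rcases lt_or_gt_of_ne hia.ne with h1 | h1
  · exact (h a i a j h1 hia.symm le_rfl hji.le hja.symm).symm
  · exact h i a j a h1 hia hji.le le_rfl hja

theorem sum_nb (hG : DC G) (hr : r ∉ b) :
    ∑ c ∈ b.filter (fun c => G.Adj c r), winv c b = qnat (nb G r b) := by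
  rw [nb, ← sum_rank]
  refine Finset.sum_congr rfl fun c hc => ?_
  simp only [Finset.mem_filter] at hc
  rw [winv, Finset.filter_filter]
  congr 2
  ext j
  simp only [Finset.mem_filter]
  constructor
  · rintro ⟨h1, h2⟩
    exact ⟨h1, hG r c j hc.2 h2 (fun h => hr (h ▸ h1)), h2⟩
  · rintro ⟨h1, _, h2⟩; exact ⟨h1, h2⟩

theorem qnat_mul (k : ℕ) : qnat k * (X - 1) = X ^ k - 1 := by
  rw [qnat, geom_sum_mul]

/-- root independence on `B` -/
def RI (G : SimpleGraph (Fin (n+1))) (B : Finset (Fin (n+1))) : Prop :=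
  ∀ r ∈ B, ∀ s ∈ B, W G winv B r = W G winv B s

theorem I_rec (hG : DC G) (hRI : ∀ b, b.card < A.card → RI G b)
    (hr : r ∈ A) (hs : s ∈ A) (hsr : s ≠ r) :
    W G winv A r = ∑ b ∈ (A.erase r).powerset.filter (fun b => s ∈ b),
      qnat (nb G r b) * W G winv b s * W G winv (A \ b) r := by
  rw [W_rec winv hr hs hsr]
  refine Finset.sum_congr rfl fun b hb => ?_
  simp only [Finset.mem_filter, Finset.mem_powerset] at hb
  have hrb : r ∉ b := fun h => by simpa using hb.1 h
  have hcard : b.card < A.card :=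
    lt_of_le_of_lt (Finset.card_le_card hb.1) (Finset.card_erase_lt_of_mem hr)
  rw [← sum_nb hG hrb, Finset.sum_mul, Finset.sum_mul]
  refine Finset.sum_congr rfl fun c hc => ?_
  rw [hRI b hcard c (Finset.mem_filter.1 hc).1 s hb.2]

/-- normalized -/
noncomputable def J (G : SimpleGraph (Fin (n+1))) (A : Finset (Fin (n+1))) (r : Fin (n+1)) :
    Polynomial ℤ := (X - 1) ^ (A.card - 1) * W G winv A r

theorem J_rec (hG : DC G) (hRI : ∀ b, b.card < A.card → RI G b)
    (hr : r ∈ A) (hs : s ∈ A) (hsr : s ≠ r) :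
    J G A r = ∑ b ∈ (A.erase r).powerset.filter (fun b => s ∈ b),
      (X ^ (nb G r b) - 1) * J G b s * J G (A \ b) r := by
  rw [J, I_rec hG hRI hr hs hsr, Finset.mul_sum]
  refine Finset.sum_congr rfl fun b hb => ?_
  simp only [Finset.mem_filter, Finset.mem_powerset] at hb
  have hrb : r ∉ b := fun h => by simpa using hb.1 h
  have hbA : b ⊆ A := hb.1.trans (Finset.erase_subset _ _)
  have h1 : 0 < b.card := Finset.card_pos.2 ⟨s, hb.2⟩
  have h2 : 0 < (A \ b).card := Finset.card_pos.2 ⟨r, by simp [hr, hrb]⟩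
  have h3 : (A \ b).card + b.card = A.card := Finset.card_sdiff_add_card_eq_card hbA
  have : A.card - 1 = 1 + (b.card - 1) + ((A \ b).card - 1) := by omega
  rw [this, ← qnat_mul, J, J, pow_add, pow_add]
  ring

/-- expansion identity on `B` -/
def EX (G : SimpleGraph (Fin (n+1))) (B : Finset (Fin (n+1))) : Prop :=
  ∀ r ∈ B, gw G B = ∑ A ∈ B.powerset.filter (fun A => r ∈ A), J G A r * gw G (B \ A)

theorem ex_step (hG : DC G) (hRI : ∀ b, b.card < B.card → RI G b)
    (hEX : ∀ b, b.card < B.card → EX G b) : EX G B := by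
  intro r hr
  by_cases hB : B = {r}
  · subst hB
    have : ({r} : Finset (Fin (n+1))).powerset.filter (fun A => r ∈ A) = {{r}} := by
      ext A
      simp only [Finset.mem_filter, Finset.mem_powerset, Finset.mem_singleton,
        Finset.subset_singleton_iff]
      constructor
      · rintro ⟨rfl | rfl, h⟩
        · simp at h
        · rfl
      · rintro rfl; simp
    rw [this, Finset.sum_singleton, J, W_single]
    have := gw_insert (G := G) (r := r) (A := ∅) (by simp)
    simp [gw_empty, nb] at this
    simp [this, gw_empty]
  · obtain ⟨s, hs, hsr⟩ : ∃ s ∈ B, s ≠ r := by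
      by_contra! h
      exact hB (Finset.eq_singleton_iff_unique_mem.2 ⟨hr, h⟩)
    set T := ∑ b ∈ (B.erase r).powerset.filter (fun b => s ∈ b),
      ∑ A ∈ (B \ b).powerset.filter (fun A => r ∈ A), J G b s * J G A r * gw G ((B \ b) \ A)
      with hT
    set U := ∑ b ∈ (B.erase r).powerset.filter (fun b => s ∈ b),
      ∑ A ∈ (B \ b).powerset.filter (fun A => r ∈ A),
        (X ^ (nb G r b) - 1) * J G b s * J G A r * gw G ((B \ b) \ A)
      with hU
    have hin : ∑ A ∈ (B.powerset.filter (fun A => r ∈ A)).filter (fun A => s ∈ A),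
        J G A r * gw G (B \ A) = U := by
      have h1 : ∀ A ∈ (B.powerset.filter (fun A => r ∈ A)).filter (fun A => s ∈ A),
          J G A r * gw G (B \ A) = ∑ b ∈ (A.erase r).powerset.filter (fun b => s ∈ b),
            (X ^ (nb G r b) - 1) * J G b s * J G (A \ b) r * gw G (B \ A) := by
        intro A hA
        simp only [Finset.mem_filter, Finset.mem_powerset] at hA
        rw [J_rec hG (fun b hb => hRI b (hb.trans_le (Finset.card_le_card hA.1.1))) hA.1.2 hA.2 hsr,
          Finset.sum_mul]
      rw [Finset.sum_congr rfl h1, hU, Finset.sum_sigma', Finset.sum_sigma']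
      refine Finset.sum_nbij' (fun q => ⟨q.2, q.1 \ q.2⟩) (fun q => ⟨q.2 ∪ q.1, q.1⟩)
        ?_ ?_ ?_ ?_ ?_
      · rintro ⟨A, b⟩ h
        simp only [Finset.mem_sigma, Finset.mem_filter, Finset.mem_powerset] at h ⊢
        obtain ⟨⟨⟨h1, h2⟩, h3⟩, h4, h5⟩ := h
        refine ⟨⟨h4.trans (Finset.erase_subset_erase _ h1), h5⟩,
          Finset.sdiff_subset_sdiff h1 le_rfl, ?_⟩
        have : r ∉ b := fun h => by simpa using h4 h
        simp [h2, this]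
      · rintro ⟨b, A⟩ h
        simp only [Finset.mem_sigma, Finset.mem_filter, Finset.mem_powerset] at h ⊢
        obtain ⟨⟨h1, h2⟩, h3, h4⟩ := h
        have hrb : r ∉ b := fun h => by simpa using h1 h
        refine ⟨⟨⟨Finset.union_subset (h3.trans Finset.sdiff_subset)
          (h1.trans (Finset.erase_subset _ _)), by simp [h4]⟩, by simp [h2]⟩, ?_, h2⟩
        intro x hx
        exact Finset.mem_erase.2 ⟨fun h => hrb (h ▸ hx), by simp [hx]⟩
      · rintro ⟨A, b⟩ h
        simp only [Finset.mem_sigma, Finset.mem_filter, Finset.mem_powerset] at h ⊢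
        simp only [Sigma.mk.injEq, heq_eq_eq, and_true]
        exact Finset.sdiff_union_of_subset (h.2.1.trans (Finset.erase_subset _ _))
      · rintro ⟨b, A⟩ h
        simp only [Finset.mem_sigma, Finset.mem_filter, Finset.mem_powerset] at h ⊢
        simp only [Sigma.mk.injEq, heq_eq_eq, true_and]
        refine Finset.union_sdiff_cancel_right ?_
        exact Finset.disjoint_of_subset_left h.2.1 Finset.sdiff_disjoint
      · rintro ⟨A, b⟩ h
        simp only [Finset.mem_sigma, Finset.mem_filter, Finset.mem_powerset] at h ⊢
        have hbA := h.2.1.trans (Finset.erase_subset _ _)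
        congr 2
        ext x
        have := @hbA x
        simp only [Finset.mem_sdiff]
        tauto
    have hout : ∑ A ∈ (B.powerset.filter (fun A => r ∈ A)).filter (fun A => ¬ s ∈ A),
        J G A r * gw G (B \ A) = T := by
      have h1 : ∀ A ∈ (B.powerset.filter (fun A => r ∈ A)).filter (fun A => ¬ s ∈ A),
          J G A r * gw G (B \ A) = ∑ b ∈ (B \ A).powerset.filter (fun b => s ∈ b),
            J G b s * J G A r * gw G ((B \ b) \ A) := by
        intro A hA
        simp only [Finset.mem_filter, Finset.mem_powerset] at hA
        rw [hEX (B \ A) ?_ s (by simp [hs, hA.2]), Finset.mul_sum]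
        · refine Finset.sum_congr rfl fun b _ => ?_
          rw [sdiff_right_comm]; ring
        · apply Finset.card_lt_card
          exact Finset.sdiff_ssubset hA.1.1 ⟨r, hA.1.2⟩
      rw [Finset.sum_congr rfl h1, hT]
      refine Finset.sum_comm' ?_
      intro A b
      simp only [Finset.mem_filter, Finset.mem_powerset, Finset.subset_sdiff, Finset.subset_erase]
      constructor
      · rintro ⟨⟨⟨h1, h2⟩, h3⟩, ⟨h4, h5⟩, h6⟩
        exact ⟨⟨⟨h1, h5.symm⟩, h2⟩, ⟨h4, fun h => Finset.disjoint_left.1 h5 h h2⟩, h6⟩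
      · rintro ⟨⟨⟨h1, h5⟩, h2⟩, ⟨h4, h3⟩, h6⟩
        exact ⟨⟨⟨h1, h2⟩, fun h => Finset.disjoint_left.1 h5 h h6⟩, ⟨h4, h5.symm⟩, h6⟩
    rw [← Finset.sum_filter_add_sum_filter_not _ (fun A => s ∈ A), hin, hout, hU, hT,
      ← Finset.sum_add_distrib]
    have hBr : r ∉ B.erase r := by simp
    have hIB : insert r (B.erase r) = B := Finset.insert_erase hr
    have h1 := gw_insert (G := G) hBr
    rw [hIB] at h1
    rw [h1, hEX (B.erase r) (Finset.card_erase_lt_of_mem hr) s (by simp [hs, hsr]), Finset.mul_sum]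
    refine Finset.sum_congr rfl fun b hb => ?_
    simp only [Finset.mem_filter, Finset.mem_powerset] at hb
    have hrb : r ∉ b := fun h => by simpa using hb.1 h
    have hbB := hb.1.trans (Finset.erase_subset _ _)
    have h2 : gw G (B \ b) = X ^ nb G r (B.erase r \ b) * gw G (B.erase r \ b) := by
      rw [← gw_insert (by simp)]
      congr 1
      ext x
      simp only [Finset.mem_sdiff, Finset.mem_insert, Finset.mem_erase]
      by_cases hx : x = r
      · subst hx; simp [hr, hrb]
      · simp [hx]
    have h3 := hEX (B \ b) (Finset.card_lt_card (Finset.sdiff_ssubset hbB ⟨s, hb.2⟩)) r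
      (by simp [hr, hrb])
    rw [nb_sdiff hb.1, ← Finset.sum_add_distrib, pow_add]
    calc _ = X ^ nb G r b * J G b s * gw G (B \ b) := by rw [h2]; ring
      _ = _ := by
        rw [h3, Finset.mul_sum]
        refine Finset.sum_congr rfl fun A _ => ?_
        ring

theorem ri_step (hRI : ∀ b, b.card < B.card → RI G b)
    (hEX : ∀ b, b.card < B.card → EX G b) (hB : EX G B) : RI G B := by
  intro r hr s hs
  by_cases hsr : s = r
  · rw [hsr]
  have key : ∀ r ∈ B, ∀ s ∈ B, s ≠ r → gw G B = J G B r +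
      ∑ A ∈ (B.powerset.filter (fun A => r ∈ A ∧ s ∈ A)).erase B, J G A r * gw G (B \ A) +
      ∑ A ∈ B.powerset.filter (fun A => r ∈ A ∧ s ∉ A),
        ∑ D ∈ (B \ A).powerset.filter (fun D => s ∈ D), J G A r * J G D s * gw G ((B \ A) \ D) := by
    intro r hr s hs hsr
    rw [hB r hr, ← Finset.sum_filter_add_sum_filter_not _ (fun A => s ∈ A), Finset.filter_filter,
      Finset.filter_filter]
    congr 1
    · rw [← Finset.add_sum_erase _ _ (a := B) (by simp [hr, hs])]
      simp [gw_empty]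
    · refine Finset.sum_congr rfl fun A hA => ?_
      simp only [Finset.mem_filter, Finset.mem_powerset] at hA
      rw [hEX (B \ A) ?_ s (by simp [hs, hA.2]), Finset.mul_sum]
      · refine Finset.sum_congr rfl fun b _ => ?_
        ring
      · apply Finset.card_lt_card
        exact Finset.sdiff_ssubset hA.1 ⟨r, hA.2.1⟩
  have h1 := key r hr s hs hsr
  rw [key s hs r hr (Ne.symm hsr)] at h1
  have e1 : ∑ A ∈ (B.powerset.filter (fun A => r ∈ A ∧ s ∈ A)).erase B, J G A r * gw G (B \ A) =
      ∑ A ∈ (B.powerset.filter (fun A => s ∈ A ∧ r ∈ A)).erase B, J G A s * gw G (B \ A) := by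
    refine Finset.sum_congr (by simp [and_comm]) fun A hA => ?_
    simp only [Finset.mem_erase, Finset.mem_filter, Finset.mem_powerset] at hA
    have : A.card < B.card := Finset.card_lt_card (Finset.ssubset_iff_subset_ne.2 ⟨hA.2.1, hA.1⟩)
    rw [J, J, hRI A this r hA.2.2.2 s hA.2.2.1]
  have e2 : ∑ A ∈ B.powerset.filter (fun A => r ∈ A ∧ s ∉ A),
        ∑ D ∈ (B \ A).powerset.filter (fun D => s ∈ D), J G A r * J G D s * gw G ((B \ A) \ D) =
      ∑ A ∈ B.powerset.filter (fun A => s ∈ A ∧ r ∉ A),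
        ∑ D ∈ (B \ A).powerset.filter (fun D => r ∈ D), J G A s * J G D r * gw G ((B \ A) \ D) := by
    rw [Finset.sum_comm' (t' := B.powerset.filter (fun A => s ∈ A ∧ r ∉ A))
      (s' := fun A => (B \ A).powerset.filter (fun D => r ∈ D))]
    · refine Finset.sum_congr rfl fun A _ => Finset.sum_congr rfl fun D _ => ?_
      rw [sdiff_right_comm]; ring
    · intro A b
      simp only [Finset.mem_filter, Finset.mem_powerset, Finset.subset_sdiff]
      constructor
      · rintro ⟨⟨h1, h2, h3⟩, ⟨h4, h5⟩, h6⟩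
        exact ⟨⟨⟨h1, h5.symm⟩, h2⟩, h4, h6, fun h => Finset.disjoint_left.1 h5 h h2⟩
      · rintro ⟨⟨⟨h1, h5⟩, h2⟩, h4, h6, h3⟩
        exact ⟨⟨h1, h2, fun h => Finset.disjoint_left.1 h5 h h6⟩, ⟨h4, h5.symm⟩, h6⟩
  rw [e1, e2] at h1
  have h2 : J G B r = J G B s := by linear_combination -h1
  rw [J, J] at h2
  have hX : (X - 1 : Polynomial ℤ) ≠ 0 := by
    have := Polynomial.X_sub_C_ne_zero (1 : ℤ)
    simpa using this
  exact mul_left_cancel₀ (pow_ne_zero _ hX) h2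

theorem root_indep (hG : DC G) : ∀ (k : ℕ) (B : Finset (Fin (n+1))), B.card = k →
    RI G B ∧ EX G B := by
  intro k
  induction k using Nat.strong_induction_on with
  | _ k ih =>
    rintro B rfl
    have h1 : ∀ b : Finset (Fin (n+1)), b.card < B.card → RI G b := fun b hb => (ih _ hb b rfl).1
    have h2 : ∀ b : Finset (Fin (n+1)), b.card < B.card → EX G b := fun b hb => (ih _ hb b rfl).2
    have h3 := ex_step hG h1 h2
    exact ⟨ri_step h1 h2 h3, h3⟩

theorem ri_all (hG : DC G) (B : Finset (Fin (n+1))) : RI G B := (root_indep hG _ B rfl).1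

/-- If the minimal-rooted enumerator is nonzero the minimum is adjacent to everything. -/
theorem star (hG : DC G) : ∀ (k : ℕ) (B : Finset (Fin (n+1))), B.card = k →
    ∀ m ∈ B, (∀ x ∈ B, m ≤ x) → W G winv B m ≠ 0 → ∀ x ∈ B, x ≠ m → G.Adj x m := by
  intro k
  induction k using Nat.strong_induction_on with
  | _ k ih =>
    rintro B rfl m hm hmin hW x hx hxm
    rw [I_rec hG (fun b _ => ri_all hG b) hm hx hxm] at hW
    obtain ⟨b, hb, hne⟩ := Finset.exists_ne_zero_of_sum_ne_zero hW
    simp only [Finset.mem_filter, Finset.mem_powerset] at hb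
    have hmb : m ∉ b := fun h => by simpa using hb.1 h
    have hcard : b.card < B.card :=
      lt_of_le_of_lt (Finset.card_le_card hb.1) (Finset.card_erase_lt_of_mem hm)
    have h1 : qnat (nb G m b) ≠ 0 := fun h => hne (by simp [h])
    have h2 : W G winv b x ≠ 0 := fun h => hne (by simp [h])
    have hnb : nb G m b ≠ 0 := fun h => h1 (by simp [h, qnat])
    obtain ⟨c, hc⟩ := Finset.card_pos.1 (Nat.pos_of_ne_zero hnb)
    simp only [Finset.mem_filter] at hc
    set m' := b.min' ⟨x, hb.2⟩ with hm'
    have hm'b : m' ∈ b := Finset.min'_mem _ _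
    have hm'm : G.Adj m' m := by
      rcases (Finset.min'_le b c hc.1).eq_or_lt with h | h
      · rw [hm', h]; exact hc.2
      · exact hG m c m' hc.2 h (fun h => hmb (h ▸ hm'b))
    by_cases hxm' : x = m'
    · rw [hxm']; exact hm'm
    · rw [ri_all hG b x hb.2 m' hm'b] at h2
      have := ih _ hcard b rfl m' hm'b (fun y hy => Finset.min'_le b y hy) h2 x hb.2 hxm'
      have hlt : m < m' := lt_of_le_of_ne (hmin m' (Finset.mem_of_mem_erase (hb.1 hm'b)))
        (fun h => hmb (h ▸ hm'b))
      exact (hG x m' m this.symm hlt (Ne.symm hxm)).symm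

theorem inc_eq (hG : DC G) : ∀ (k : ℕ) (B : Finset (Fin (n+1))), B.card = k →
    ∀ m ∈ B, (∀ x ∈ B, m ≤ x) → W G winv B m = W G winc B m := by
  intro k
  induction k using Nat.strong_induction_on with
  | _ k ih =>
    rintro B rfl m hm hmin
    by_cases hB : B = {m}
    · rw [hB, W_single, W_single]
    obtain ⟨s, hs, hsm⟩ : ∃ s ∈ B, s ≠ m := by
      by_contra! h
      exact hB (Finset.eq_singleton_iff_unique_mem.2 ⟨hm, h⟩)
    rw [I_rec hG (fun b _ => ri_all hG b) hm hs hsm, W_rec winc hm hs hsm]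
    refine Finset.sum_congr rfl fun b hb => ?_
    simp only [Finset.mem_filter, Finset.mem_powerset] at hb
    have hmb : m ∉ b := fun h => by simpa using hb.1 h
    have hcard : b.card < B.card :=
      lt_of_le_of_lt (Finset.card_le_card hb.1) (Finset.card_erase_lt_of_mem hm)
    have hbB := hb.1.trans (Finset.erase_subset _ _)
    set m' := b.min' ⟨s, hb.2⟩ with hm'
    have hm'b : m' ∈ b := Finset.min'_mem _ _
    have hm'min : ∀ y ∈ b, m' ≤ y := fun y hy => Finset.min'_le b y hy
    rw [ri_all hG b s hb.2 m' hm'b]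
    have hrest : W G winv (B \ b) m = W G winc (B \ b) m :=
      ih _ (Finset.card_lt_card (Finset.sdiff_ssubset hbB ⟨s, hb.2⟩)) _ rfl m (by simp [hm, hmb])
        (fun x hx => hmin x (Finset.mem_sdiff.1 hx).1)
    have hbb : W G winv b m' = W G winc b m' := ih _ hcard b rfl m' hm'b hm'min
    have hz : ∀ c ∈ b, c ≠ m' → winc c b = 0 := by
      intro c hc hcm
      rw [winc, if_neg]
      intro h
      exact hcm (le_antisymm (h m' hm'b) (hm'min c hc))
    by_cases hadj : G.Adj m' m
    · rw [Finset.sum_eq_single m']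
      · rw [← hrest, ← hbb]
        by_cases hW : W G winv b m' = 0
        · simp [hW]
        · have hall : ∀ x ∈ b, G.Adj x m := by
            intro x hx
            by_cases hxm' : x = m'
            · rw [hxm']; exact hadj
            have := star hG _ b rfl m' hm'b hm'min hW x hx hxm'
            have hlt : m < m' := lt_of_le_of_ne (hmin m' (hbB hm'b))
              (fun h => hmb (h ▸ hm'b))
            exact (hG x m' m this.symm hlt (fun h => hmb (h ▸ hx))).symm
          rw [nb, Finset.filter_true_of_mem hall, winc, if_pos hm'min]
      · intro c hc hcm
        rw [hz c (Finset.mem_filter.1 hc).1 hcm]; simp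
      · intro h; simp [hm'b, hadj] at h
    · have hnone : b.filter (fun c => G.Adj c m) = ∅ := by
        rw [Finset.filter_eq_empty_iff]
        intro c hc hcm
        rcases (hm'min c hc).eq_or_lt with h | h
        · exact hadj (h ▸ hcm)
        · exact hadj (hG m c m' hcm h (fun h => hmb (h ▸ hm'b)))
      rw [nb, hnone]; simp [qnat]

end Algebra

theorem isT_iff {n : ℕ} {G : SimpleGraph (Fin (n+1))} {p : Fin (n+1) → Fin (n+1)} :
    IsT G Finset.univ 0 p ↔ IsSpanTree n G p := by
  simp [IsT, IsSpanTree, Desc]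

theorem treeInv_eq {n : ℕ} (p : Fin (n+1) → Fin (n+1)) :
    treeInv n p = ∑ i ∈ Finset.univ.erase (0 : Fin (n+1)),
      ((dset p i).filter (fun j => j < i)).card := by
  rw [← Finset.card_sigma, treeInv]
  rw [← Set.ncard_coe_finset]
  refine Set.ncard_congr (fun a _ => ⟨a.1, a.2⟩) ?_ ?_ ?_
  · rintro ⟨i, j⟩ ⟨h1, h2, h3⟩
    simp only [Finset.coe_sigma, Set.mem_sigma_iff, Finset.mem_coe, Finset.mem_filter, mem_dset]
    exact ⟨by simpa using h2, h3, h1⟩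
  · rintro ⟨i, j⟩ ⟨i', j'⟩ _ _ h
    simpa using h
  · rintro ⟨i, j⟩ h
    simp only [Finset.coe_sigma, Set.mem_sigma_iff, Finset.mem_coe, Finset.mem_filter, mem_dset] at h
    exact ⟨(i, j), ⟨h.2.2, by simpa using h.1, h.2.1⟩, rfl⟩

theorem delta_eq {n : ℕ} (p : Fin (n+1) → Fin (n+1)) (i : Fin (n+1)) :
    delta n p i = (dset p i).card := by
  rw [delta, ← Set.ncard_coe_finset]
  congr 1
  ext j; simp [mem_dset]

theorem incr_iff {n : ℕ} (p : Fin (n+1) → Fin (n+1)) :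
    IsIncr n p ↔ ∀ i ∈ Finset.univ.erase (0 : Fin (n+1)), ∀ j ∈ dset p i, i ≤ j := by
  simp only [IsIncr, invSet, Set.eq_empty_iff_forall_notMem, Set.mem_setOf_eq, Prod.forall,
    mem_dset, Finset.mem_erase, Finset.mem_univ, and_true]
  constructor
  · intro h i hi j hj
    by_contra hlt
    exact h i j ⟨not_le.1 hlt, hi, hj⟩
  · rintro h i j ⟨h1, h2, h3⟩
    exact absurd (h i h2 j h3) (not_le.2 h1)

theorem sum_inv_eq_sum_increasing (n : ℕ) (hn : 1 ≤ n) (G : SimpleGraph (Fin (n+1)))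
    (hG : IsThreshold n G) (hc : G.Connected) :
    ∑ᶠ p ∈ {p | IsSpanTree n G p}, (X : Polynomial ℤ) ^ treeInv n p =
      ∑ᶠ p ∈ {p | IsSpanTree n G p ∧ IsIncr n p},
        ∏ i ∈ Finset.univ.erase (0 : Fin (n+1)), qnat (delta n p i) := by
  have h := inc_eq (dc_of_threshold hG) _ Finset.univ rfl 0 (Finset.mem_univ _)
    (fun x _ => Fin.zero_le x)
  have e1 : ({p | IsSpanTree n G p} : Set (Fin (n+1) → Fin (n+1))) =
      ((Finset.univ.filter (fun p => IsT G Finset.univ 0 p) : Finset _) : Set _) := by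
    ext p; simp [isT_iff]
  have e2 : ({p | IsSpanTree n G p ∧ IsIncr n p} : Set (Fin (n+1) → Fin (n+1))) =
      (((Finset.univ.filter (fun p => IsT G Finset.univ 0 p)).filter (fun p => IsIncr n p) :
        Finset _) : Set _) := by
    ext p; simp [isT_iff]
  rw [e1, e2, finsum_mem_coe_finset, finsum_mem_coe_finset]
  conv_rhs => rw [Finset.sum_filter]
  rw [W, W] at h
  convert h using 1
  · refine Finset.sum_congr rfl fun p _ => ?_
    rw [treeInv_eq, ← Finset.prod_pow_eq_pow_sum]
    rfl
  · refine Finset.sum_congr rfl fun p _ => ?_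
    split_ifs with hp
    · rw [incr_iff] at hp
      refine Finset.prod_congr rfl fun i hi => ?_
      rw [winc, if_pos (hp i hi), delta_eq]
    · rw [incr_iff] at hp
      push Not at hp
      obtain ⟨i, hi, j, hj, hij⟩ := hp
      symm
      refine Finset.prod_eq_zero hi ?_
      rw [winc, if_neg]
      intro h
      exact absurd (h j hj) (not_le.2 hij)

end ThresholdFlow
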